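/- Let P and Q be non-reverse polylines satisfying the hypotheses of the sorted sum (first shifts of the same direction and rot P = rot Q). If aco P > −π and aco Q > −π, then rot(P +ₛ Q) = rot P = rot Q. -/

import Mathlib

open Real Set Pointwise

noncomputable section

/-- The signed angle from `v` to `w`, in `(-π, π]`; for nonzero non-opposite
vectors it lies in `(-π, π)` and its sign is the sign of the skew product. -/
def vangle (v w : ℝ × ℝ) : ℝ :=
  Complex.arg ((w.1 + w.2 * Complex.I) / (v.1 + v.2 * Complex.I))

/-- `w` is opposite to `v` : `w = a • v` with `a < 0`. -/
def Opp (v w : ℝ × ℝ) : Prop := ∃ a : ℝ, a < 0 ∧ w = a • v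

/-- A shift sequence is non-reverse if no two consecutive shifts are opposite. -/
def NonReverse (s : List (ℝ × ℝ)) : Prop := List.Chain' (fun v w => ¬ Opp v w) s

/-- The rotation of a polyline with the given shift sequence:
the sum of the signed angles between consecutive shifts. -/
def rotShifts : List (ℝ × ℝ) → ℝ
  | v :: w :: rest => vangle v w + rotShifts (w :: rest)
  | _ => 0

/-- The angular convexity of a polyline with shift sequence `s` :
the minimum of the rotations of its contiguous subpolylines. -/
def acoShifts (s : List (ℝ × ℝ)) : ℝ :=
  sInf (rotShifts '' { t : List (ℝ × ℝ) | t <:+: s })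

/-- The (cyclic) rotation of a closed polyline with shift sequence `s`. -/
def rotClosed (s : List (ℝ × ℝ)) : ℝ := rotShifts (s ++ s.take 1)

/-- The angular convexity of a closed polyline with shift sequence `s` :
the minimum of the rotations over all (possibly wrapping) contiguous
subpolylines traversing the cycle at most once, oriented along it. -/
def acoClosed (s : List (ℝ × ℝ)) : ℝ :=
  sInf (rotShifts '' { t : List (ℝ × ℝ) | t.length ≤ s.length ∧ t <:+: (s ++ s) })

/-- A polyline, given by its first vertex and its shift sequence. -/
structure Polyline where
  start : ℝ × ℝ
  shifts : List (ℝ × ℝ)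

namespace Polyline

/-- A genuine polyline: at least one edge and consecutive vertices distinct. -/
def Proper (P : Polyline) : Prop := P.shifts ≠ [] ∧ ∀ v ∈ P.shifts, v ≠ 0

/-- The `i`-th vertex (`0`-indexed). -/
def vert (P : Polyline) (i : ℕ) : ℝ × ℝ := P.start + (P.shifts.take i).sum

/-- The natural piecewise-linear parameterization of `P` on `[0, number of edges]`. -/
def param (P : Polyline) (t : ℝ) : ℝ × ℝ :=
  P.vert ⌊t⌋.toNat + Int.fract t • P.shifts.getD ⌊t⌋.toNat 0

/-- The polyline as a subset of the plane. -/
def trace (P : Polyline) : Set (ℝ × ℝ) := P.param '' Set.Icc 0 (P.shifts.length : ℝ)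

/-- A closed polyline: the last vertex equals the first one. -/
def Closed (P : Polyline) : Prop := P.shifts.sum = 0

/-- A simple (open) polyline: edges may intersect only at a common vertex of
consecutive edges, i.e. the natural parameterization is injective. -/
def Simple (P : Polyline) : Prop := Set.InjOn P.param (Set.Icc 0 (P.shifts.length : ℝ))

/-- A simple closed polyline: closed and injective except for first = last point. -/
def SimpleClosed (P : Polyline) : Prop :=
  P.Closed ∧ Set.InjOn P.param (Set.Ico 0 (P.shifts.length : ℝ))

/-- The `i`-th edge as a segment in the plane. -/
def edge (P : Polyline) (i : ℕ) : Set (ℝ × ℝ) := segment ℝ (P.vert i) (P.vert (i + 1))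

/-- A polyline is in general position if all vertices are distinct, two edges meet
in at most one point which is either the common vertex of consecutive edges or lies
in the relative interiors of both, and no three edges have a common point. -/
def GeneralPosition (P : Polyline) : Prop :=
  (∀ i j, i < j → j ≤ P.shifts.length → P.vert i ≠ P.vert j) ∧
  (∀ i j, i < j → j < P.shifts.length →
    (P.edge i ∩ P.edge j).Subsingleton ∧
    ∀ x ∈ P.edge i ∩ P.edge j,
      (j = i + 1 ∧ x = P.vert j) ∨
      (x ∈ openSegment ℝ (P.vert i) (P.vert (i + 1)) ∧
        x ∈ openSegment ℝ (P.vert j) (P.vert (j + 1)))) ∧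
  ∀ i j k, i < j → j < k → k < P.shifts.length →
    P.edge i ∩ P.edge j ∩ P.edge k = ∅

end Polyline

/-- `P` is the (anticlockwise-oriented) closed simple boundary polyline of the
simple polygon `K`. -/
structure IsSimplePolygon (K : Set (ℝ × ℝ)) (P : Polyline) : Prop where
  compact : IsCompact K
  regular : K = closure (interior K)
  proper : P.Proper
  nonReverse : NonReverse (P.shifts ++ P.shifts.take 1)
  simpleClosed : P.SimpleClosed
  boundary : frontier K = P.trace
  orient : rotClosed P.shifts = 2 * π

/-- The ray with apex `x` and direction `d`. -/
def ray (x d : ℝ × ℝ) : Set (ℝ × ℝ) := {y | ∃ t : ℝ, 0 ≤ t ∧ y = x + t • d}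

/-- The angular region with apex `x` spanned by the directions `u` and `v` :
the convex hull of the two rays. Its angular measure is `|vangle u v|`. -/
def angularRegion (x u v : ℝ × ℝ) : Set (ℝ × ℝ) :=
  convexHull ℝ (ray x u ∪ ray x v)

/-- The merge of two shift sequences used in the sorted sum: repeatedly take the
head of the remaining sequence with the larger rotation (preferring the first). -/
def sortedMerge : List (ℝ × ℝ) → List (ℝ × ℝ) → List (ℝ × ℝ)
  | [], t => t
  | s, [] => s
  | a :: s, b :: t =>
    if rotShifts (b :: t) ≤ rotShifts (a :: s) then a :: sortedMerge s (b :: t)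
    else b :: sortedMerge (a :: s) t
termination_by s t => s.length + t.length

/-- The hypotheses of the sorted sum: both polylines are proper and non-reverse,
their first shifts have the same direction, and their rotations are equal. -/
def SortedSumHyp (P Q : Polyline) : Prop :=
  P.Proper ∧ Q.Proper ∧ NonReverse P.shifts ∧ NonReverse Q.shifts ∧
  vangle P.shifts.headI Q.shifts.headI = 0 ∧
  rotShifts P.shifts = rotShifts Q.shifts

/-- The sorted sum `P +ₛ Q` : starts at the sum of the first vertices and has the
merged shift sequence. -/
def sortedSum (P Q : Polyline) : Polyline :=
  ⟨P.start + Q.start, sortedMerge P.shifts Q.shifts⟩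

/-- Direction of a plane vector as an angle. -/
def dirA (v : ℝ × ℝ) : Real.Angle := ((Complex.arg (v.1 + v.2 * Complex.I) : ℝ) : Real.Angle)

lemma cplx_ne {v : ℝ × ℝ} (hv : v ≠ 0) : ((v.1 : ℂ) + v.2 * Complex.I) ≠ 0 := by
  intro h
  apply hv
  have h1 := congrArg Complex.re h
  have h2 := congrArg Complex.im h
  simp at h1 h2
  exact Prod.ext h1 h2

lemma vangle_coe {v w : ℝ × ℝ} (hv : v ≠ 0) (hw : w ≠ 0) :
    (vangle v w : Real.Angle) = dirA w - dirA v :=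
  Complex.arg_div_coe_angle (cplx_ne hw) (cplx_ne hv)

lemma vangle_key {d : Real.Angle} {a b : ℝ × ℝ} {x y : ℝ} (ha : a ≠ 0) (hb : b ≠ 0)
    (hx : (x : Real.Angle) = d - dirA a) (hy : (y : Real.Angle) = d - dirA b)
    (h1 : -π < x - y) (h2 : x - y < π) : vangle a b = x - y := by
  have h : (vangle a b : Real.Angle) = ((x - y : ℝ) : Real.Angle) := by
    rw [vangle_coe ha hb, Real.Angle.coe_sub, hx, hy]; abel
  have h3 : (vangle a b : Real.Angle).toReal = vangle a b :=
    Real.Angle.toReal_coe_eq_self_iff.2 ⟨Complex.neg_pi_lt_arg _, Complex.arg_le_pi _⟩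
  have h4 : ((x - y : ℝ) : Real.Angle).toReal = x - y :=
    Real.Angle.toReal_coe_eq_self_iff.2 ⟨h1, h2.le⟩
  rw [← h3, h, h4]

lemma vangle_lt_pi {v w : ℝ × ℝ} (hv : v ≠ 0) (h : ¬ Opp v w) : vangle v w < π := by
  refine lt_of_le_of_ne (Complex.arg_le_pi _) fun he => h ?_
  have hz := Complex.arg_eq_pi_iff.1 he
  set z : ℂ := ((w.1 : ℂ) + w.2 * Complex.I) / (v.1 + v.2 * Complex.I) with hzdef
  have hw : ((w.1 : ℂ) + w.2 * Complex.I) = z * (v.1 + v.2 * Complex.I) := by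
    rw [hzdef, div_mul_cancel₀ _ (cplx_ne hv)]
  refine ⟨z.re, hz.1, ?_⟩
  have h1 := congrArg Complex.re hw
  have h2 := congrArg Complex.im hw
  simp [hz.2] at h1 h2
  exact Prod.ext (by simpa using h1) (by simpa using h2)

/-- Invariant for the remaining shift sequences during the merge. -/
def GoodS (d : Real.Angle) : List (ℝ × ℝ) → Prop
  | [] => True
  | a :: t => a ≠ 0 ∧ -π < rotShifts (a :: t) ∧
      (rotShifts (a :: t) : Real.Angle) = d - dirA a ∧
      (∀ b ∈ t.head?, vangle a b < π) ∧ GoodS d t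

lemma merge_rot (d : Real.Angle) : ∀ (n : ℕ) (a b : ℝ × ℝ) (s t : List (ℝ × ℝ)),
    s.length + t.length ≤ n → GoodS d (a :: s) → GoodS d (b :: t) →
    rotShifts (sortedMerge (a :: s) (b :: t)) =
      max (rotShifts (a :: s)) (rotShifts (b :: t)) := by
  intro n
  induction n with
  | zero =>
    intro a b s t hn ha hb
    obtain rfl : s = [] := List.length_eq_zero_iff.1 (by omega)
    obtain rfl : t = [] := List.length_eq_zero_iff.1 (by omega)
    have := vangle_key ha.1 hb.1 ha.2.2.1 hb.2.2.1 (by simp [rotShifts, pi_pos])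
      (by simp [rotShifts, pi_pos])
    simp [sortedMerge, rotShifts] at this ⊢
    exact this
  | succ n ih =>
    intro a b s t hn ha hb
    rw [sortedMerge]
    split_ifs with hle
    · rw [max_eq_left hle]
      cases s with
      | nil =>
        have h0 : rotShifts [a] = 0 := rfl
        rw [h0] at hle
        have := vangle_key ha.1 hb.1 ha.2.2.1 hb.2.2.1 (by rw [h0]; linarith [pi_pos])
          (by rw [h0]; linarith [hb.2.1])
        rw [sortedMerge, rotShifts, this]; ring
      | cons a' s' =>
        have hI := ih a' b s' t (by simp at hn; omega) ha.2.2.2.2 hb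
        have hlt := ha.2.2.2.1 a' (by simp)
        have hr : rotShifts (a :: a' :: s') = vangle a a' + rotShifts (a' :: s') := rfl
        rw [sortedMerge] at hI ⊢
        split_ifs at hI ⊢ with h2
        · rw [rotShifts, hI, max_eq_left h2, hr]
        · rw [rotShifts, hI, max_eq_right (not_le.1 h2).le]
          have := vangle_key ha.1 hb.1 ha.2.2.1 hb.2.2.1 (by linarith [pi_pos])
            (by linarith [not_le.1 h2])
          rw [this]; ring
    · rw [not_le] at hle
      rw [max_eq_right hle.le]
      cases t with
      | nil =>
        have h0 : rotShifts [b] = 0 := rfl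
        rw [h0] at hle
        have := vangle_key hb.1 ha.1 hb.2.2.1 ha.2.2.1 (by rw [h0]; linarith [pi_pos])
          (by rw [h0]; linarith [ha.2.1])
        rw [sortedMerge, rotShifts, this]; · ring
        simp
      | cons b' t' =>
        have hI := ih a b' s t' (by simp at hn; omega) ha hb.2.2.2.2
        have hlt := hb.2.2.2.1 b' (by simp)
        have hr : rotShifts (b :: b' :: t') = vangle b b' + rotShifts (b' :: t') := rfl
        rw [sortedMerge] at hI ⊢
        split_ifs at hI ⊢ with h2
        · rw [rotShifts, hI, max_eq_left h2]
          have := vangle_key hb.1 ha.1 hb.2.2.1 ha.2.2.1 (by linarith [pi_pos])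
            (by linarith)
          rw [this]; ring
        · rw [rotShifts, hI, max_eq_right (not_le.1 h2).le, hr]

lemma goodS_of (d : Real.Angle) : ∀ (s : List (ℝ × ℝ)), (∀ v ∈ s, v ≠ 0) → NonReverse s →
    (∀ t, t <:+ s → -π < rotShifts t) →
    (∀ a ∈ s.head?, (rotShifts s : Real.Angle) = d - dirA a) → GoodS d s := by
  intro s
  induction s with
  | nil => intros; trivial
  | cons a t ih =>
    intro h0 hn hs hd
    have hc : List.IsChain (fun v w => ¬ Opp v w) (a :: t) := hn
    refine ⟨h0 a (by simp), hs _ List.suffix_rfl, hd a (by simp), ?_, ?_⟩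
    · intro b hb
      exact vangle_lt_pi (h0 a (by simp)) ((List.isChain_cons.1 hc).1 b hb)
    · refine ih (fun v hv => h0 v (by simp [hv])) (List.isChain_cons.1 hc).2
        (fun u hu => hs u (hu.trans (List.suffix_cons a t))) ?_
      intro b hb
      cases t with
      | nil => simp at hb
      | cons c t' =>
        simp at hb
        subst hb
        have h1 := hd a (by simp)
        rw [rotShifts, Real.Angle.coe_add,
          vangle_coe (h0 a (by simp)) (h0 c (by simp))] at h1
        have h2 : (rotShifts (c :: t') : Real.Angle) =
          (dirA c - dirA a + rotShifts (c :: t')) - (dirA c - dirA a) := by abel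
        rw [h2, h1]; abel

lemma aco_suffix {s : List (ℝ × ℝ)} (h : -π < acoShifts s) (t : List (ℝ × ℝ)) (ht : t <:+ s) :
    -π < rotShifts t := by
  refine h.trans_le (csInf_le ?_ ⟨t, ht.isInfix, rfl⟩)
  refine (Set.Finite.image _ ?_).bddBelow
  refine (List.finite_toSet s.sublists).subset ?_
  intro u hu
  exact List.mem_sublists.2 (List.IsInfix.sublist hu)

/-- **Lemma (rotation of the sorted sum).** If `P, Q` satisfy the sorted-sum
hypotheses and `aco P, aco Q > -π`, then `rot (P +ₛ Q) = rot P = rot Q`. -/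
theorem sortedSum_rot (P Q : Polyline) (h : SortedSumHyp P Q)
    (hP : -π < acoShifts P.shifts) (hQ : -π < acoShifts Q.shifts) :
    rotShifts (sortedSum P Q).shifts = rotShifts P.shifts ∧
    rotShifts (sortedSum P Q).shifts = rotShifts Q.shifts := by
  obtain ⟨p0, S⟩ := P
  obtain ⟨q0, T⟩ := Q
  obtain ⟨⟨hS, hS0⟩, ⟨hT, hT0⟩, hSn, hTn, hang, hrot⟩ := h
  simp only [sortedSum] at *
  rw [← hrot, and_self]
  obtain ⟨a, s, rfl⟩ := List.exists_cons_of_ne_nil hS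
  obtain ⟨b, t, rfl⟩ := List.exists_cons_of_ne_nil hT
  simp only [List.headI] at hang
  have hdir : dirA b = dirA a := by
    have := vangle_coe (hS0 a (by simp)) (hT0 b (by simp))
    rw [hang, Real.Angle.coe_zero] at this
    exact (sub_eq_zero.1 this.symm)
  have h1 : GoodS ((rotShifts (a :: s) : Real.Angle) + dirA a) (a :: s) :=
    goodS_of _ _ hS0 hSn (aco_suffix hP) (by intro c hc; simp at hc; subst hc; abel)
  have h2 : GoodS ((rotShifts (a :: s) : Real.Angle) + dirA a) (b :: t) :=
    goodS_of _ _ hT0 hTn (aco_suffix hQ)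
      (by intro c hc; simp at hc; subst hc; rw [hdir, hrot]; abel)
  rw [merge_rot _ _ a b s t le_rfl h1 h2, ← hrot, max_self]
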